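/- Fix finite nonempty sets Θ, Ω, A, and let C° be the set of pairs (u,μ) ∈ ℝ^{Θ×Ω×A} × Δ(Ω×Θ) with μ(ω) > 0 for every ω ∈ Ω, equipped with the standard topology. Then the optimal Pricing Outcomes revenue R : C° → ℝ is lower-semicontinuous: for every sequence (u_i,μ_i) → (u,μ) in C°, liminf_i R(u_i,μ_i) ≥ R(u,μ). -/

import Mathlib

open Finset Filter

noncomputable section

variable {Θ Ω A : Type*}

/-- `p` is a probability distribution on the finite set `Ω`. -/
def IsDist [Fintype Ω] (p : Ω → ℝ) : Prop :=
  (∀ ω, 0 ≤ p ω) ∧ ∑ ω, p ω = 1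

/-- `μ` is a joint probability distribution on `Ω × Θ`. -/
def IsJoint [Fintype Ω] [Fintype Θ] (μ : Ω → Θ → ℝ) : Prop :=
  (∀ ω θ, 0 ≤ μ ω θ) ∧ ∑ ω, ∑ θ, μ ω θ = 1

/-- The marginal `μ(ω) = ∑_θ μ(ω,θ)` of a joint distribution. -/
def margO [Fintype Θ] (μ : Ω → Θ → ℝ) (ω : Ω) : ℝ := ∑ θ, μ ω θ

/-- The marginal `μ(θ) = ∑_ω μ(ω,θ)` of a joint distribution. -/
def margT [Fintype Ω] (μ : Ω → Θ → ℝ) (θ : Θ) : ℝ := ∑ ω, μ ω θ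

/-- The value function `v_θ(q) = max_{a ∈ A} ∑_ω q(ω)·u(θ,ω,a)`. -/
def vfun [Fintype Ω] [Fintype A] [Nonempty A] (u : Θ → Ω → A → ℝ) (θ : Θ) (q : Ω → ℝ) : ℝ :=
  univ.sup' univ_nonempty fun a => ∑ ω, q ω * u θ ω a

/-- The matrix-vector product `D_θ q`, where `D_θ` is the diagonal matrix with entries
`μ(θ|ω) = μ(ω,θ)/μ(ω)`. -/
def Dq [Fintype Θ] (μ : Ω → Θ → ℝ) (θ : Θ) (q : Ω → ℝ) : Ω → ℝ :=
  fun ω => μ ω θ / margO μ ω * q ω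

/-- `1ᵀ D_θ q`. -/
def onesD [Fintype Θ] [Fintype Ω] (μ : Ω → Θ → ℝ) (θ : Θ) (q : Ω → ℝ) : ℝ :=
  ∑ ω, Dq μ θ q ω

/-- A feasible signal-representation for prior `pr`: a finitely supported distribution over
posteriors (each posterior being a distribution on `Ω`) averaging to the prior. -/
def FeasRep [Fintype Ω] (pr : Ω → ℝ) (x : (Ω → ℝ) →₀ ℝ) : Prop :=
  (∀ q ∈ x.support, IsDist q) ∧ (∀ q, 0 ≤ x q) ∧
  (∑ q ∈ x.support, x q = 1) ∧ ∀ ω, ∑ q ∈ x.support, x q * q ω = pr ω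

variable [Fintype Θ] [Fintype Ω] [Fintype A] [Nonempty A]

/-- Expected value `∑_q v_θ(D_θ q)·x(q)` that a type-`θ` buyer gets from
signal representation `x`. -/
def PMutil (u : Θ → Ω → A → ℝ) (μ : Ω → Θ → ℝ) (θ : Θ) (x : (Ω → ℝ) →₀ ℝ) : ℝ :=
  ∑ q ∈ x.support, vfun u θ (Dq μ θ q) * x q

/-- Validity (IR and IC) of a Pricing Mappings menu `{(x_θ, t_θ)}`. -/
def PMvalid (u : Θ → Ω → A → ℝ) (μ : Ω → Θ → ℝ)
    (x : Θ → ((Ω → ℝ) →₀ ℝ)) (t : Θ → ℝ) : Prop :=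
  (∀ θ, FeasRep (margO μ) (x θ)) ∧ (∀ θ, 0 ≤ t θ) ∧
  (∀ θ, vfun u θ (Dq μ θ (margO μ)) ≤ PMutil u μ θ (x θ) - margT μ θ * t θ) ∧
  (∀ θ θ', θ' ≠ θ →
    PMutil u μ θ (x θ') - margT μ θ * t θ' ≤ PMutil u μ θ (x θ) - margT μ θ * t θ)

/-- Revenue `∑_θ μ(θ)·t_θ` of a Pricing Mappings menu. -/
def PMrev (μ : Ω → Θ → ℝ) (t : Θ → ℝ) : ℝ := ∑ θ, margT μ θ * t θ

/-- `R_c(u,μ)`: the supremum of revenues of valid Pricing Mappings menus. -/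
def Rc (u : Θ → Ω → A → ℝ) (μ : Ω → Θ → ℝ) : ℝ :=
  sSup {r | ∃ x t, PMvalid u μ x t ∧ r = PMrev μ t}

/-- Net utility `∑_q [v_θ(D_θ q)·x(q) − (1ᵀD_θ q)·t̃(q)]` of a type-`θ` buyer
from a Pricing Outcomes contract `(x, tt)`. -/
def POutil (u : Θ → Ω → A → ℝ) (μ : Ω → Θ → ℝ) (θ : Θ)
    (x tt : (Ω → ℝ) →₀ ℝ) : ℝ :=
  ∑ q ∈ x.support ∪ tt.support,
    (vfun u θ (Dq μ θ q) * x q - onesD μ θ q * tt q)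

/-- Validity (feasibility, payments supported on signals, IR and IC) of a Pricing Outcomes
menu `{(x_θ, t̃_θ)}`. -/
def POvalid (u : Θ → Ω → A → ℝ) (μ : Ω → Θ → ℝ)
    (x tt : Θ → ((Ω → ℝ) →₀ ℝ)) : Prop :=
  (∀ θ, FeasRep (margO μ) (x θ)) ∧ (∀ θ, (tt θ).support ⊆ (x θ).support) ∧
  (∀ θ, vfun u θ (Dq μ θ (margO μ)) ≤ POutil u μ θ (x θ) (tt θ)) ∧
  (∀ θ θ', θ' ≠ θ →
    POutil u μ θ (x θ') (tt θ') ≤ POutil u μ θ (x θ) (tt θ))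

/-- Revenue `∑_θ ∑_q (1ᵀD_θ q)·t̃_θ(q)` of a Pricing Outcomes menu. -/
def POrev (μ : Ω → Θ → ℝ) (tt : Θ → ((Ω → ℝ) →₀ ℝ)) : ℝ :=
  ∑ θ, ∑ q ∈ (tt θ).support, onesD μ θ q * tt θ q

/-- `R(u,μ)`: the supremum of revenues of valid Pricing Outcomes menus. -/
def Rfull (u : Θ → Ω → A → ℝ) (μ : Ω → Θ → ℝ) : ℝ :=
  sSup {r | ∃ x tt, POvalid u μ x tt ∧ r = POrev μ tt}

/-- `R_p(u,μ)`: the supremum of revenues of valid Pricing Outcomes menus with no positive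
transfers to the buyer, i.e. all payments nonnegative. -/
def Rp (u : Θ → Ω → A → ℝ) (μ : Ω → Θ → ℝ) : ℝ :=
  sSup {r | ∃ x tt, POvalid u μ x tt ∧ (∀ θ q, 0 ≤ tt θ q) ∧ r = POrev μ tt}

/-- `max_a u(θ,ω,a)`. -/
def maxU (u : Θ → Ω → A → ℝ) (θ : Θ) (ω : Ω) : ℝ :=
  univ.sup' univ_nonempty fun a => u θ ω a

/-- The buyer surplus
`σ(θ) = ∑_ω μ(ω|θ)·max_a u(θ,ω,a) − max_a ∑_ω μ(ω|θ)·u(θ,ω,a)`. -/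
def surplus (u : Θ → Ω → A → ℝ) (μ : Ω → Θ → ℝ) (θ : Θ) : ℝ :=
  ∑ ω, μ ω θ / margT μ θ * maxU u θ ω -
    univ.sup' univ_nonempty fun a => ∑ ω, μ ω θ / margT μ θ * u θ ω a

/-- The full surplus `∑_θ μ(θ)·σ(θ)`. -/
def fullSurplus (u : Θ → Ω → A → ℝ) (μ : Ω → Θ → ℝ) : ℝ :=
  ∑ θ, margT μ θ * surplus u μ θ

/-- The sealed-envelope revenue `R_e(u,μ) = sup_{t ≥ 0} t·∑_{θ : μ(θ)>0, σ(θ) ≥ t} μ(θ)`. -/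
def Re (u : Θ → Ω → A → ℝ) (μ : Ω → Θ → ℝ) : ℝ :=
  sSup {r | ∃ t : ℝ, 0 ≤ t ∧
    r = t * ∑ θ, (if 0 < margT μ θ ∧ t ≤ surplus u μ θ then margT μ θ else 0)}

/-- The cell of the simplex on which, for each type `θ`, action `α θ` is optimal:
on this polytope every `v_θ` is linear. -/
def cellPM (u : Θ → Ω → A → ℝ) (α : Θ → A) : Set (Ω → ℝ) :=
  {q | IsDist q ∧ ∀ θ a, ∑ ω, q ω * u θ ω a ≤ ∑ ω, q ω * u θ ω (α θ)}

/-- `Q*(u)`: the set of vertices (extreme points) of the cells of the partition of the simplex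
into polytopes on which every `v_θ` is linear. -/
def Qstar (u : Θ → Ω → A → ℝ) : Set (Ω → ℝ) :=
  ⋃ α : Θ → A, Set.extremePoints ℝ (cellPM u α)

/-- The cell of the simplex on which, for each type `θ`, action `α θ` is optimal for the
transformed posterior `D_θ q`: on this polytope every `q ↦ v_θ(D_θ q)` is linear. -/
def cellPO (u : Θ → Ω → A → ℝ) (μ : Ω → Θ → ℝ) (α : Θ → A) : Set (Ω → ℝ) :=
  {q | IsDist q ∧ ∀ θ a, ∑ ω, Dq μ θ q ω * u θ ω a ≤ ∑ ω, Dq μ θ q ω * u θ ω (α θ)}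

/-- `Q*(u,μ)`: the set of vertices (extreme points) of the cells of the partition of the simplex
into polytopes on which every `q ↦ v_θ(D_θ q)` is linear. -/
def QstarD (u : Θ → Ω → A → ℝ) (μ : Ω → Θ → ℝ) : Set (Ω → ℝ) :=
  ⋃ α : Θ → A, Set.extremePoints ℝ (cellPO u μ α)

/-- The point mass at `ω`, as an element of `Δ(Ω)`. -/
def deltaP [DecidableEq Ω] (ω : Ω) : Ω → ℝ := fun ω' => if ω' = ω then 1 else 0

/-- The full-revelation signal representation: posterior `δ_ω` with probability `μ(ω)`. -/
def fullX [DecidableEq Ω] (μ : Ω → Θ → ℝ) : (Ω → ℝ) →₀ ℝ :=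
  ∑ ω, Finsupp.single (deltaP ω) (margO μ ω)

/-- The full-revelation payment function: `t̃(δ_ω) = μ(ω)·t(ω)`. -/
def fullT [DecidableEq Ω] (μ : Ω → Θ → ℝ) (t : Ω → ℝ) : (Ω → ℝ) →₀ ℝ :=
  ∑ ω, Finsupp.single (deltaP ω) (margO μ ω * t ω)

set_option linter.unusedSectionVars false

/-- The expected payment `∑_q (1ᵀD_θ q)·t̃(q)` of a type-`θ` buyer. -/
def expPay (μ : Ω → Θ → ℝ) (θ : Θ) (t : (Ω → ℝ) →₀ ℝ) : ℝ :=
  ∑ q ∈ t.support, onesD μ θ q * t q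

lemma sum_support_eq_linearCombination (f : (Ω → ℝ) → ℝ) (x : (Ω → ℝ) →₀ ℝ) :
    ∑ q ∈ x.support, f q * x q = Finsupp.linearCombination ℝ f x := by
  simp [Finsupp.linearCombination_apply, Finsupp.sum, mul_comm]

lemma PMutil_eq_linearCombination (u : Θ → Ω → A → ℝ) (μ : Ω → Θ → ℝ) (θ : Θ)
    (x : (Ω → ℝ) →₀ ℝ) :
    PMutil u μ θ x = Finsupp.linearCombination ℝ (fun q => vfun u θ (Dq μ θ q)) x :=
  sum_support_eq_linearCombination _ x

lemma expPay_eq_linearCombination (μ : Ω → Θ → ℝ) (θ : Θ) (t : (Ω → ℝ) →₀ ℝ) :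
    expPay μ θ t = Finsupp.linearCombination ℝ (onesD μ θ) t :=
  sum_support_eq_linearCombination _ t

lemma POutil_eq_sub (u : Θ → Ω → A → ℝ) (μ : Ω → Θ → ℝ) (θ : Θ) (x t : (Ω → ℝ) →₀ ℝ) :
    POutil u μ θ x t = PMutil u μ θ x - expPay μ θ t := by
  unfold POutil PMutil expPay
  rw [sum_sub_distrib]
  congr 1
  · refine (sum_subset subset_union_left fun q _ hq => ?_).symm
    simp [Finsupp.notMem_support_iff.1 hq]
  · refine (sum_subset subset_union_right fun q _ hq => ?_).symm
    simp [Finsupp.notMem_support_iff.1 hq]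

/-- Letting every type pick its favourite contract from a family that contains the uninformative
free contract gives a valid menu. -/
lemma POvalid_of_favourite {M : Type*} {u : Θ → Ω → A → ℝ} {μ : Ω → Θ → ℝ}
    {x t : M → ((Ω → ℝ) →₀ ℝ)} {s : Θ → M} {m₀ : M}
    (hx : ∀ m, FeasRep (margO μ) (x m)) (ht : ∀ m, (t m).support ⊆ (x m).support)
    (hx₀ : x m₀ = Finsupp.single (margO μ) 1) (ht₀ : t m₀ = 0)
    (hs : ∀ θ m, POutil u μ θ (x m) (t m) ≤ POutil u μ θ (x (s θ)) (t (s θ))) :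
    POvalid u μ (fun θ => x (s θ)) (fun θ => t (s θ)) := by
  refine ⟨fun θ => hx _, fun θ => ht _, fun θ => ?_, fun θ θ' _ => hs θ (s θ')⟩
  refine le_trans (le_of_eq ?_) (hs θ m₀)
  simp [POutil_eq_sub, PMutil_eq_linearCombination, expPay_eq_linearCombination, hx₀, ht₀]

lemma IsJoint.isDist_margO {μ : Ω → Θ → ℝ} (hμ : IsJoint μ) : IsDist (margO μ) :=
  ⟨fun ω => sum_nonneg fun θ _ => hμ.1 ω θ, hμ.2⟩

lemma FeasRep.single {p : Ω → ℝ} (hp : IsDist p) : FeasRep p (Finsupp.single p 1) := by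
  refine ⟨?_, ?_, ?_, ?_⟩
  · simp [hp]
  · intro q
    classical
    rw [Finsupp.single_apply]
    split_ifs <;> norm_num
  · simp
  · simp

/-- Shrink `x` by `c` and fully reveal the rest of the prior mass, so that a representation for
`p` becomes one for `p'`. -/
def mixReveal (c : ℝ) (p p' : Ω → ℝ) (x : (Ω → ℝ) →₀ ℝ) : (Ω → ℝ) →₀ ℝ := by
  classical
  exact c • x + ∑ ω, Finsupp.single (Pi.single ω 1) (p' ω - c * p ω)

lemma linearCombination_mixReveal [DecidableEq Ω] (f : (Ω → ℝ) → ℝ) (c : ℝ) (p p' : Ω → ℝ)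
    (x : (Ω → ℝ) →₀ ℝ) :
    Finsupp.linearCombination ℝ f (mixReveal c p p' x) =
      c * Finsupp.linearCombination ℝ f x
        + ∑ ω, (p' ω - c * p ω) * f (Pi.single ω 1) := by
  simp only [mixReveal, map_add, map_smul, map_sum, Finsupp.linearCombination_single, smul_eq_mul]
  congr! 5

lemma mul_le_mixReveal {c : ℝ} {p p' : Ω → ℝ} (hcp : ∀ ω, c * p ω ≤ p' ω)
    (x : (Ω → ℝ) →₀ ℝ) (q : Ω → ℝ) : c * x q ≤ mixReveal c p p' x q := by
  classical
  simp only [mixReveal, Finsupp.add_apply, Finsupp.smul_apply, smul_eq_mul,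
    Finsupp.finsetSum_apply, le_add_iff_nonneg_right]
  refine sum_nonneg fun ω _ => ?_
  rw [Finsupp.single_apply]
  split_ifs
  · linarith [hcp ω]
  · exact le_rfl

lemma FeasRep.mixReveal {c : ℝ} {p p' : Ω → ℝ} {x : (Ω → ℝ) →₀ ℝ} (hx : FeasRep p x)
    (hp : IsDist p) (hp' : IsDist p') (hc : 0 ≤ c) (hcp : ∀ ω, c * p ω ≤ p' ω) :
    FeasRep p' (mixReveal c p p' x) := by
  classical
  obtain ⟨h₁, h₂, h₃, h₄⟩ := hx
  refine ⟨fun q hq => ?_, fun q => (mul_nonneg hc (h₂ q)).trans (mul_le_mixReveal hcp x q), ?_,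
    fun ω => ?_⟩
  · by_cases hqx : q ∈ x.support
    · exact h₁ q hqx
    by_cases hex : ∃ ω : Ω, Pi.single ω 1 = q
    · obtain ⟨ω, rfl⟩ := hex
      refine ⟨fun ω' => ?_, by simp⟩
      rw [Pi.single_apply]
      split_ifs <;> norm_num
    · refine absurd ?_ (Finsupp.mem_support_iff.1 hq)
      simp only [_root_.mixReveal, Finsupp.add_apply, Finsupp.smul_apply, smul_eq_mul,
        Finsupp.finsetSum_apply, Finsupp.notMem_support_iff.1 hqx, mul_zero, zero_add]
      refine sum_eq_zero fun ω _ => Finsupp.single_eq_of_ne' fun h => hex ⟨ω, ?_⟩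
      rw [← h]
  · have e (y : (Ω → ℝ) →₀ ℝ) :
        ∑ q ∈ y.support, y q = Finsupp.linearCombination ℝ (fun _ => (1 : ℝ)) y := by
      simp [← sum_support_eq_linearCombination]
    rw [e] at h₃
    rw [e, linearCombination_mixReveal, h₃]
    simp [sum_sub_distrib, ← mul_sum, hp.2, hp'.2]
  · have e (y : (Ω → ℝ) →₀ ℝ) :
        ∑ q ∈ y.support, y q * q ω = Finsupp.linearCombination ℝ (fun q => q ω) y := by
      simp [← sum_support_eq_linearCombination, mul_comm]
    have h := h₄ ω
    rw [e] at h
    rw [e, linearCombination_mixReveal, h]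
    simp [Pi.single_apply]

lemma support_subset_support_mixReveal {c : ℝ} {p p' : Ω → ℝ} {x : (Ω → ℝ) →₀ ℝ}
    (hx : FeasRep p x) (hc : 0 < c) (hcp : ∀ ω, c * p ω ≤ p' ω) :
    x.support ⊆ (mixReveal c p p' x).support := by
  intro q hq
  have h₀ : 0 < x q := (hx.2.1 q).lt_of_ne' (Finsupp.mem_support_iff.1 hq)
  exact Finsupp.mem_support_iff.2 ((mul_pos hc h₀).trans_le (mul_le_mixReveal hcp x q)).ne'

/-- A bound on the value of any posterior distribution to a type-`θ` buyer. -/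
def valueBound (u : Θ → Ω → A → ℝ) (μ : Ω → Θ → ℝ) (θ : Θ) : ℝ :=
  ∑ ω, ∑ a, |μ ω θ / margO μ ω| * |u θ ω a|

lemma abs_vfun_Dq_le (u : Θ → Ω → A → ℝ) (μ : Ω → Θ → ℝ) (θ : Θ) {q : Ω → ℝ} (hq : IsDist q) :
    |vfun u θ (Dq μ θ q)| ≤ valueBound u μ θ := by
  obtain ⟨a, -, ha⟩ := exists_mem_eq_sup' univ_nonempty fun a => ∑ ω, Dq μ θ q ω * u θ ω a
  rw [vfun, ha]
  refine (abs_sum_le_sum_abs _ _).trans (sum_le_sum fun ω _ => ?_)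
  have hq1 : |q ω| ≤ 1 := by
    rw [abs_of_nonneg (hq.1 ω), ← hq.2]
    exact single_le_sum (f := q) (fun i _ => hq.1 i) (mem_univ ω)
  calc |Dq μ θ q ω * u θ ω a| = |μ ω θ / margO μ ω| * |u θ ω a| * |q ω| := by
        rw [Dq, abs_mul, abs_mul]; ring
    _ ≤ |μ ω θ / margO μ ω| * |u θ ω a| := mul_le_of_le_one_right (by positivity) hq1
    _ ≤ _ := single_le_sum (f := fun a => |μ ω θ / margO μ ω| * |u θ ω a|)
        (fun _ _ => by positivity) (mem_univ a)

lemma PMutil_le_valueBound {u : Θ → Ω → A → ℝ} {μ : Ω → Θ → ℝ} {p : Ω → ℝ} (θ : Θ)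
    {x : (Ω → ℝ) →₀ ℝ} (hx : FeasRep p x) : PMutil u μ θ x ≤ valueBound u μ θ := by
  calc PMutil u μ θ x ≤ ∑ q ∈ x.support, valueBound u μ θ * x q :=
        sum_le_sum fun q hq => mul_le_mul_of_nonneg_right
          ((le_abs_self _).trans (abs_vfun_Dq_le u μ θ (hx.1 q hq))) (hx.2.1 q)
    _ = _ := by rw [← mul_sum, hx.2.2.1, mul_one]

lemma POrev_le {u : Θ → Ω → A → ℝ} {μ : Ω → Θ → ℝ} (hμ : IsJoint μ)
    {x tt : Θ → ((Ω → ℝ) →₀ ℝ)} (h : POvalid u μ x tt) :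
    POrev μ tt ≤ ∑ θ, 2 * valueBound u μ θ := by
  refine sum_le_sum fun θ _ => ?_
  have h₁ := h.2.2.1 θ
  rw [POutil_eq_sub] at h₁
  have h₂ := PMutil_le_valueBound (u := u) (μ := μ) θ (h.1 θ)
  have h₃ := neg_abs_le (vfun u θ (Dq μ θ (margO μ)))
  have h₄ := abs_vfun_Dq_le u μ θ hμ.isDist_margO
  change expPay μ θ (tt θ) ≤ _
  linarith

lemma POrev_le_Rfull {u : Θ → Ω → A → ℝ} {μ : Ω → Θ → ℝ} (hμ : IsJoint μ)
    {x tt : Θ → ((Ω → ℝ) →₀ ℝ)} (h : POvalid u μ x tt) : POrev μ tt ≤ Rfull u μ := by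
  refine le_csSup ⟨∑ θ, 2 * valueBound u μ θ, ?_⟩ ⟨x, tt, h, rfl⟩
  rintro r ⟨x, tt, h, rfl⟩
  exact POrev_le hμ h

lemma Rfull_le {u : Θ → Ω → A → ℝ} {μ : Ω → Θ → ℝ} (hμ : IsJoint μ) :
    Rfull u μ ≤ ∑ θ, 2 * valueBound u μ θ := by
  refine Real.sSup_le ?_ ?_
  · rintro r ⟨x, tt, h, rfl⟩
    exact POrev_le hμ h
  · unfold valueBound
    positivity

lemma exists_POvalid (u : Θ → Ω → A → ℝ) {μ : Ω → Θ → ℝ} (hμ : IsJoint μ) :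
    ∃ x tt, POvalid u μ x tt :=
  ⟨_, _, POvalid_of_favourite (M := Unit) (x := fun _ => Finsupp.single (margO μ) 1)
    (t := fun _ => 0) (s := fun _ => ()) (m₀ := ()) (fun _ => .single hμ.isDist_margO)
    (by simp) rfl rfl fun _ _ => le_rfl⟩

section Continuity

variable {ι : Type*} {l : Filter ι} {useq : ι → Θ → Ω → A → ℝ} {u : Θ → Ω → A → ℝ}
  {μseq : ι → Ω → Θ → ℝ} {μ : Ω → Θ → ℝ}

lemma tendsto_margO (hμ : Tendsto μseq l (nhds μ)) (ω : Ω) :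
    Tendsto (fun i => margO (μseq i) ω) l (nhds (margO μ ω)) :=
  tendsto_finsetSum _ fun θ _ => (hμ.apply_nhds ω).apply_nhds θ

lemma tendsto_kernel (hμ : Tendsto μseq l (nhds μ)) (hO : ∀ ω, 0 < margO μ ω) (ω : Ω) (θ : Θ) :
    Tendsto (fun i => μseq i ω θ / margO (μseq i) ω) l (nhds (μ ω θ / margO μ ω)) :=
  ((hμ.apply_nhds ω).apply_nhds θ).div (tendsto_margO hμ ω) (hO ω).ne'

lemma tendsto_vfun_Dq (hu : Tendsto useq l (nhds u)) (hμ : Tendsto μseq l (nhds μ))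
    (hO : ∀ ω, 0 < margO μ ω) (θ : Θ) {qseq : ι → Ω → ℝ} {q : Ω → ℝ}
    (hq : ∀ ω, Tendsto (fun i => qseq i ω) l (nhds (q ω))) :
    Tendsto (fun i => vfun (useq i) θ (Dq (μseq i) θ (qseq i))) l
      (nhds (vfun u θ (Dq μ θ q))) := by
  refine Tendsto.finset_sup'_nhds_apply _ fun a _ => tendsto_finsetSum _ fun ω _ => ?_
  exact ((tendsto_kernel hμ hO ω θ).mul (hq ω)).mul
    (((hu.apply_nhds θ).apply_nhds ω).apply_nhds a)

lemma tendsto_PMutil (hu : Tendsto useq l (nhds u)) (hμ : Tendsto μseq l (nhds μ))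
    (hO : ∀ ω, 0 < margO μ ω) (θ : Θ) (x : (Ω → ℝ) →₀ ℝ) :
    Tendsto (fun i => PMutil (useq i) (μseq i) θ x) l (nhds (PMutil u μ θ x)) := by
  unfold PMutil
  exact tendsto_finsetSum _ fun q _ =>
    (tendsto_vfun_Dq hu hμ hO θ fun ω => tendsto_const_nhds (x := q ω)).mul_const (x q)

lemma tendsto_expPay (hμ : Tendsto μseq l (nhds μ)) (hO : ∀ ω, 0 < margO μ ω) (θ : Θ)
    (t : (Ω → ℝ) →₀ ℝ) :
    Tendsto (fun i => expPay (μseq i) θ t) l (nhds (expPay μ θ t)) :=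
  tendsto_finsetSum _ fun _ _ => (tendsto_finsetSum _ fun ω _ =>
    (tendsto_kernel hμ hO ω θ).mul_const _).mul_const _

lemma tendsto_valueBound (hu : Tendsto useq l (nhds u)) (hμ : Tendsto μseq l (nhds μ))
    (hO : ∀ ω, 0 < margO μ ω) (θ : Θ) :
    Tendsto (fun i => valueBound (useq i) (μseq i) θ) l (nhds (valueBound u μ θ)) :=
  tendsto_finsetSum _ fun ω _ => tendsto_finsetSum _ fun a _ =>
    (tendsto_kernel hμ hO ω θ).abs.mul (((hu.apply_nhds θ).apply_nhds ω).apply_nhds a).abs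

lemma tendsto_PMutil_mixReveal (hu : Tendsto useq l (nhds u)) (hμ : Tendsto μseq l (nhds μ))
    (hO : ∀ ω, 0 < margO μ ω) {c : ι → ℝ} (hc : Tendsto c l (nhds 1)) (θ : Θ)
    (x : (Ω → ℝ) →₀ ℝ) :
    Tendsto (fun i => PMutil (useq i) (μseq i) θ
      (mixReveal (c i) (margO μ) (margO (μseq i)) x)) l (nhds (PMutil u μ θ x)) := by
  classical
  have h := (hc.mul (tendsto_PMutil hu hμ hO θ x)).add (tendsto_finsetSum univ fun ω _ =>
    ((tendsto_margO hμ ω).sub (hc.mul_const (margO μ ω))).mul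
      (tendsto_vfun_Dq hu hμ hO θ fun ω' =>
        tendsto_const_nhds (x := (Pi.single ω 1 : Ω → ℝ) ω')))
  simp only [PMutil_eq_linearCombination, linearCombination_mixReveal] at h ⊢
  simpa using h

/-- Discounting the payments of a valid menu by a factor `1 - η` makes its revenue robust to
perturbations of the context. -/
lemma eventually_discounted_revenue_le_Rfull (hu : Tendsto useq l (nhds u))
    (hμ : Tendsto μseq l (nhds μ)) (hJ : IsJoint μ) (hO : ∀ ω, 0 < margO μ ω)
    (hJseq : ∀ i, IsJoint (μseq i)) {x tt : Θ → ((Ω → ℝ) →₀ ℝ)} (hv : POvalid u μ x tt)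
    {η δ : ℝ} (hη : 0 < η) (hη1 : η < 1) (hδ : 0 < δ) :
    ∀ᶠ i in l, (1 - η) * POrev μ tt - δ ≤ Rfull (useq i) (μseq i) := by
  classical
  obtain ⟨hF, hS, hIR, hIC⟩ := hv
  set c : ι → ℝ := fun i => 1 - ∑ ω, |margO (μseq i) ω - margO μ ω| / margO μ ω with hcdef
  have hc : Tendsto c l (nhds 1) := by
    have h : Tendsto (fun i => 1 - ∑ ω, |margO (μseq i) ω - margO μ ω| / margO μ ω) l
        (nhds (1 - ∑ ω, |margO μ ω - margO μ ω| / margO μ ω)) :=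
      (tendsto_finsetSum _ fun ω _ =>
        ((tendsto_margO hμ ω).sub_const _).abs.div_const _).const_sub 1
    simpa using h
  have hcp (i : ι) (ω : Ω) : c i * margO μ ω ≤ margO (μseq i) ω := by
    have h₁ : |margO (μseq i) ω - margO μ ω| / margO μ ω ≤ 1 - c i := by
      rw [hcdef, sub_sub_cancel]
      exact single_le_sum (f := fun ω => |margO (μseq i) ω - margO μ ω| / margO μ ω)
        (fun ω _ => div_nonneg (abs_nonneg _) (hO ω).le) (mem_univ ω)
    rw [div_le_iff₀ (hO ω)] at h₁
    linarith [neg_abs_le (margO (μseq i) ω - margO μ ω)]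
  let X : ι → Option Θ → ((Ω → ℝ) →₀ ℝ) := fun i m =>
    m.elim (Finsupp.single (margO (μseq i)) 1)
      fun θ => mixReveal (c i) (margO μ) (margO (μseq i)) (x θ)
  let T : Option Θ → ((Ω → ℝ) →₀ ℝ) := fun m => m.elim 0 tt
  let V : Θ → Option Θ → ℝ := fun θ m =>
    m.elim (vfun u θ (Dq μ θ (margO μ))) fun θ' => PMutil u μ θ (x θ')
  have hbest (θ : Θ) (m : Option Θ) :
      V θ m - expPay μ θ (T m) ≤ V θ (some θ) - expPay μ θ (T (some θ)) := by
    rcases m with _ | θ'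
    · simpa [V, T, POutil_eq_sub, expPay_eq_linearCombination] using hIR θ
    · by_cases h : θ' = θ
      · rw [h]
      · simpa [V, T, POutil_eq_sub] using hIC θ θ' h
  have hV (θ : Θ) (m : Option Θ) :
      Tendsto (fun i => PMutil (useq i) (μseq i) θ (X i m)) l (nhds (V θ m)) := by
    rcases m with _ | θ'
    · simpa [X, V, PMutil_eq_linearCombination] using
        tendsto_vfun_Dq hu hμ hO θ (tendsto_margO hμ)
    · exact tendsto_PMutil_mixReveal hu hμ hO hc θ (x θ')
  have hU (θ : Θ) (m : Option Θ) :
      Tendsto (fun i => POutil (useq i) (μseq i) θ (X i m) ((1 - η) • T m)) l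
        (nhds (V θ m - (1 - η) * expPay μ θ (T m))) := by
    simp only [POutil_eq_sub, expPay_eq_linearCombination, map_smul, smul_eq_mul]
    simp only [← expPay_eq_linearCombination]
    exact (hV θ m).sub ((tendsto_expPay hμ hO θ (T m)).const_mul _)
  have hchoice : ∀ᶠ i in l, ∀ (θ : Θ) (m : Option Θ),
      expPay μ θ (T m) < expPay μ θ (T (some θ)) →
      POutil (useq i) (μseq i) θ (X i m) ((1 - η) • T m) <
        POutil (useq i) (μseq i) θ (X i (some θ)) ((1 - η) • T (some θ)) := by
    refine eventually_all.2 fun θ => eventually_all.2 fun m => ?_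
    by_cases h : expPay μ θ (T m) < expPay μ θ (T (some θ))
    · have hlt : V θ m - (1 - η) * expPay μ θ (T m) <
          V θ (some θ) - (1 - η) * expPay μ θ (T (some θ)) := by
        nlinarith [hbest θ m, mul_lt_mul_of_pos_left h hη]
      filter_upwards [(hU θ m).eventually_lt (hU θ (some θ)) hlt] with i hi _ using hi
    · exact Eventually.of_forall fun i h' => absurd h' h
  have hrev : ∀ᶠ i in l, ∀ s : Θ → Option Θ,
      (1 - η) * ∑ θ, expPay μ θ (T (s θ)) - δ <
        (1 - η) * ∑ θ, expPay (μseq i) θ (T (s θ)) := by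
    refine eventually_all.2 fun s => ?_
    exact ((tendsto_finsetSum univ fun θ _ =>
      tendsto_expPay hμ hO θ (T (s θ))).const_mul (1 - η)).eventually_const_lt (by linarith)
  filter_upwards [hchoice, hrev, hc.eventually_const_lt one_pos] with i h₁ h₂ h₃
  choose s hs using fun θ => Finite.exists_max fun m =>
    POutil (useq i) (μseq i) θ (X i m) ((1 - η) • T m)
  have hXF (m : Option Θ) : FeasRep (margO (μseq i)) (X i m) := by
    rcases m with _ | θ
    · exact .single (hJseq i).isDist_margO
    · exact (hF θ).mixReveal hJ.isDist_margO (hJseq i).isDist_margO h₃.le (hcp i)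
  have hTS (m : Option Θ) : ((1 - η) • T m).support ⊆ (X i m).support := by
    rcases m with _ | θ
    · simp [T]
    · exact (Finsupp.support_smul.trans (hS θ)).trans
        (support_subset_support_mixReveal (hF θ) h₃ (hcp i))
  have hval := POvalid_of_favourite (m₀ := none) hXF hTS rfl (smul_zero _) hs
  refine le_trans ?_ (POrev_le_Rfull (hJseq i) hval)
  have hge : POrev μ tt ≤ ∑ θ, expPay μ θ (T (s θ)) :=
    sum_le_sum fun θ _ => not_lt.1 fun hlt => (h₁ θ (s θ) hlt).not_ge (hs θ (some θ))
  have hmul := mul_le_mul_of_nonneg_left hge (sub_pos.2 hη1).le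
  have hfin : POrev (μseq i) (fun θ => (1 - η) • T (s θ)) =
      (1 - η) * ∑ θ, expPay (μseq i) θ (T (s θ)) := by
    change ∑ θ, expPay (μseq i) θ ((1 - η) • T (s θ)) = _
    simp only [expPay_eq_linearCombination, map_smul, smul_eq_mul, mul_sum]
  rw [hfin]
  linarith [h₂ s]

end Continuity

/-- The optimal Pricing Outcomes revenue `R` is lower-semicontinuous on
the set `C°` of contexts whose prior has positive `Ω`-marginal: along any sequence of
contexts in `C°` converging to a context in `C°`, the liminf of the optimal revenues is at
least the optimal revenue at the limit. -/
theorem Rfull_lower_semicontinuous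
    (u : Θ → Ω → A → ℝ) (μ : Ω → Θ → ℝ)
    (hμ : IsJoint μ) (hO : ∀ ω, 0 < margO μ ω)
    (useq : ℕ → Θ → Ω → A → ℝ) (μseq : ℕ → Ω → Θ → ℝ)
    (hmem : ∀ i, IsJoint (μseq i) ∧ ∀ ω, 0 < margO (μseq i) ω)
    (hconv : Tendsto (fun i => (useq i, μseq i)) atTop (nhds (u, μ))) :
    Rfull u μ ≤ atTop.liminf fun i => Rfull (useq i) (μseq i) := by
  have hu : Tendsto useq atTop (nhds u) := hconv.fst_nhds
  have hμs : Tendsto μseq atTop (nhds μ) := hconv.snd_nhds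
  have hbdd : IsBoundedUnder (· ≤ ·) atTop fun i => Rfull (useq i) (μseq i) :=
    (tendsto_finsetSum univ fun θ _ =>
      (tendsto_valueBound hu hμs hO θ).const_mul 2).isBoundedUnder_le.mono_le
      (Eventually.of_forall fun i => Rfull_le (hmem i).1)
  refine le_of_forall_lt fun b hb => ?_
  obtain ⟨a, hba, ha⟩ := exists_between hb
  refine hba.trans_le (le_liminf_of_le hbdd.isCoboundedUnder_ge ?_)
  obtain ⟨x₀, tt₀, h₀⟩ := exists_POvalid u hμ
  obtain ⟨_, ⟨x, tt, hv, rfl⟩, hlt⟩ :=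
    exists_lt_of_lt_csSup (s := {r | ∃ x tt, POvalid u μ x tt ∧ r = POrev μ tt}) ⟨POrev μ tt₀, x₀, tt₀, h₀, rfl⟩
      ha
  have hlim : Tendsto (fun η : ℝ => (1 - η) * POrev μ tt) (nhdsWithin 0 (Set.Ioi 0))
      (nhds (POrev μ tt)) := by
    have h : Continuous fun η : ℝ => (1 - η) * POrev μ tt := by fun_prop
    simpa using h.continuousWithinAt (s := Set.Ioi 0) (x := 0) |>.tendsto
  obtain ⟨η, hη, hη0, hη1⟩ :=
    ((hlim.eventually_const_lt hlt).and (Ioo_mem_nhdsGT one_pos)).exists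
  filter_upwards [eventually_discounted_revenue_le_Rfull hu hμs hμ hO (fun i => (hmem i).1) hv
    hη0 hη1 (sub_pos.2 hη)] with i hi
  linarith
end
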